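/- arXiv:nlin/0205063 — 2 statements merged into one kernel-verified Lean document; each statement's English description precedes it below -/
import Mathlib

section
/- Fix an integer N and elements y, z ∈ K with y ≠ 0 and z ≠ 0, and assume φ_{N−1}(y,z) ≠ 0 and φ_N(y/q,z/q) ≠ 0. Set F1 = φ_{N−1}(y/q,z/q) · φ_N(y,z) / (φ_{N−1}(y,z) · φ_N(y/q,z/q)). Then the multiplicative formulas hold: 1 + (y/z)·F1 = (1 + y/z) · φ_{N−1}(y/q,z) · φ_N(y,z/q) / (φ_{N−1}(y,z) · φ_N(y/q,z/q)), and 1 + (z/y)·F1 = (1 + z/y) · φ_{N−1}(y,z/q) · φ_N(y/q,z) / (φ_{N−1}(y,z) · φ_N(y/q,z/q)). -/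
open Matrix Finset

/-- The Jacobi--Trudi type determinant: `det (p (n - 2i + j) y z)_{0 ≤ i,j ≤ n-1}`. -/
noncomputable def phiAux {K : Type*} [Field K] (p : ℤ → K → K → K) (n : ℕ) (y z : K) : K :=
  Matrix.det (Matrix.of fun i j : Fin n => p ((n : ℤ) - 2 * ((i : ℕ) : ℤ) + ((j : ℕ) : ℤ)) y z)

/-- The polynomials `φ_N(y,z)`: for `N ≥ 0` the Jacobi--Trudi determinant (with `φ_0 = 1`
as the empty determinant), and for `N < 0` we set `φ_N = (-1)^(N(N+1)/2) φ_(-N-1)`. -/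
noncomputable def phi {K : Type*} [Field K] (p : ℤ → K → K → K) (N : ℤ) (y z : K) : K :=
  if 0 ≤ N then phiAux p N.toNat y z
  else (-1 : K) ^ (N * (N + 1) / 2) * phiAux p (-N - 1).toNat y z

section Plucker

variable {R : Type*} [CommRing R] {m : ℕ}

/-- The matrix with rows `x, y, u 0, …, u (m - 1)`. -/
def pairRows (u : Fin m → Fin (m + 2) → R) (x y : Fin (m + 2) → R) :
    Matrix (Fin (m + 2)) (Fin (m + 2)) R :=
  Matrix.of (Fin.cons x (Fin.cons y u : Fin (m + 1) → Fin (m + 2) → R))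

/-- The matrix with rows `x, u 0, …, u (m - 1), w`. -/
def endRows (u : Fin m → Fin (m + 2) → R) (w x : Fin (m + 2) → R) :
    Matrix (Fin (m + 2)) (Fin (m + 2)) R :=
  Matrix.of (Fin.cons x (Fin.snoc u w : Fin (m + 1) → Fin (m + 2) → R))

/-- The determinant of `endRows u w x` as a linear form in `x`. -/
def endDet (u : Fin m → Fin (m + 2) → R) (w : Fin (m + 2) → R) : (Fin (m + 2) → R) →ₗ[R] R where
  toFun x := (endRows u w x).det
  map_add' x y := by
    have key : ∀ x, endRows u w x = (endRows u w 0).updateRow 0 x := by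
      intro x; ext i j; refine Fin.cases ?_ (fun i => ?_) i <;> simp [endRows, Matrix.updateRow_apply]
    rw [key x, key y, key (x + y), Matrix.det_updateRow_add]
  map_smul' r x := by
    have key : ∀ x, endRows u w x = (endRows u w 0).updateRow 0 x := by
      intro x; ext i j; refine Fin.cases ?_ (fun i => ?_) i <;> simp [endRows, Matrix.updateRow_apply]
    rw [key x, key (r • x), Matrix.det_updateRow_smul]; rfl

lemma endDet_apply_self (u : Fin m → Fin (m + 2) → R) (w : Fin (m + 2) → R) (i : Fin m) :
    endDet u w (u i) = 0 := by
  refine Matrix.det_zero_of_row_eq (i := 0) (j := i.castSucc.succ) (Fin.succ_ne_zero _).symm ?_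
  ext k
  simp [endRows]

/-- The determinant of `pairRows u x y` as a bilinear form in `x, y`. -/
def pairDet (u : Fin m → Fin (m + 2) → R) :
    (Fin (m + 2) → R) →ₗ[R] (Fin (m + 2) → R) →ₗ[R] R :=
  have key : ∀ x y x', pairRows u x y = (pairRows u x' y).updateRow 0 x := by
    intro x y x'; ext i j
    refine Fin.cases ?_ (fun i => ?_) i <;> simp [pairRows, Matrix.updateRow_apply]
  have key' : ∀ x y y', pairRows u x y = (pairRows u x y').updateRow 1 y := by
    intro x y y'; ext i j
    refine Fin.cases ?_ (fun i => Fin.cases ?_ (fun i => ?_) i) i <;>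
      simp [pairRows, Matrix.updateRow_apply, Fin.ext_iff]
  LinearMap.mk₂ R (fun x y => (pairRows u x y).det)
    (fun x x' y => by
      rw [key x y 0, key x' y 0, key (x + x') y 0, Matrix.det_updateRow_add])
    (fun r x y => by rw [key x y 0, key (r • x) y 0, Matrix.det_updateRow_smul]; rfl)
    (fun x y y' => by
      rw [key' x y 0, key' x y' 0, key' x (y + y') 0, Matrix.det_updateRow_add])
    (fun r x y => by rw [key' x y 0, key' x (r • y) 0, Matrix.det_updateRow_smul]; rfl)

lemma pairDet_apply (u : Fin m → Fin (m + 2) → R) (x y : Fin (m + 2) → R) :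
    pairDet u x y = (pairRows u x y).det := rfl

lemma endDet_apply (u : Fin m → Fin (m + 2) → R) (w x : Fin (m + 2) → R) :
    endDet u w x = (endRows u w x).det := rfl

lemma pairDet_self (u : Fin m → Fin (m + 2) → R) (x : Fin (m + 2) → R) :
    pairDet u x x = 0 := by
  refine Matrix.det_zero_of_row_eq (i := 0) (j := (0 : Fin (m + 1)).succ)
    (Fin.succ_ne_zero _).symm ?_
  ext k
  simp [pairRows]

lemma pairDet_swap (u : Fin m → Fin (m + 2) → R) (x y : Fin (m + 2) → R) :
    pairDet u x y = -pairDet u y x := by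
  have h := pairDet_self u (x + y)
  simp only [map_add, LinearMap.add_apply, pairDet_self] at h
  linear_combination h

/-- The three-term Plücker relation. -/
lemma pairDet_mul_endDet (u : Fin m → Fin (m + 2) → R) (w x y z : Fin (m + 2) → R) :
    pairDet u x y * endDet u w z = pairDet u z y * endDet u w x + pairDet u x z * endDet u w y := by
  have h := Matrix.mulVec_cramer (pairRows u x y)ᵀ z
  rw [Matrix.mulVec_eq_sum, Fin.sum_univ_succ, Fin.sum_univ_succ, Matrix.det_transpose] at h
  have h' := congrArg (endDet u w) h
  have e0 : Matrix.cramer (pairRows u x y)ᵀ z 0 = pairDet u z y := by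
    rw [Matrix.cramer_transpose_apply, pairDet_apply]
    congr 1
    ext i j
    refine Fin.cases ?_ (fun i => ?_) i <;> simp [pairRows, Matrix.updateRow_apply]
  have e1 : Matrix.cramer (pairRows u x y)ᵀ z (Fin.succ 0) = pairDet u x z := by
    rw [Matrix.cramer_transpose_apply, pairDet_apply]
    congr 1
    ext i j
    refine Fin.cases ?_ (fun i => Fin.cases ?_ (fun i => ?_) i) i <;>
      simp [pairRows, Matrix.updateRow_apply, Fin.ext_iff]
  have r0 : (pairRows u x y) 0 = x := by ext; simp [pairRows]
  have r1 : (pairRows u x y) (Fin.succ 0) = y := by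
    ext
    simp only [pairRows, Matrix.of_apply, Fin.cons_succ, Fin.cons_zero]
  have r2 : ∀ i : Fin m, (pairRows u x y) i.succ.succ = u i := by intro i; ext; simp [pairRows]
  simp only [e0, e1, Matrix.transpose_transpose, r0, r1, r2, map_add, map_sum, map_smul,
    op_smul_eq_smul, endDet_apply_self, mul_zero, Finset.sum_const_zero, smul_eq_mul, add_zero,
    ← pairDet_apply] at h'
  exact h'.symm

end Plucker

section Staircase

variable {R : Type*} [CommRing R]

/-- The staircase Jacobi--Trudi determinant of a sequence. -/
def staircaseDet (n : ℕ) (g : ℤ → R) : R :=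
  Matrix.det (Matrix.of fun i j : Fin n => g ((n : ℤ) - 2 * ((i : ℕ) : ℤ) + ((j : ℕ) : ℤ)))

/-- Multiplication of the generating function of `g` by `1 - a t`. -/
def mulLinear (a : R) (g : ℤ → R) : ℤ → R := fun k => g k - a * g (k - 1)

lemma mulLinear_comm (a b : R) (g : ℤ → R) :
    mulLinear a (mulLinear b g) = mulLinear b (mulLinear a g) := by
  funext k; simp only [mulLinear]; ring

lemma mulLinear_zero_left (g : ℤ → R) : mulLinear 0 g = g := by
  funext k; simp [mulLinear]

lemma mulLinear_of_neg {a : R} {g : ℤ → R} (hg : ∀ k < 0, g k = 0) :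
    ∀ k < 0, mulLinear a g k = 0 := by
  intro k hk
  simp [mulLinear, hg k hk, hg (k - 1) (by lia)]

lemma mulLinear_zero {a : R} {g : ℤ → R} (hg : ∀ k < 0, g k = 0) :
    mulLinear a g 0 = g 0 := by
  simp [mulLinear, hg]

lemma staircaseDet_eq_det_rev (n : ℕ) (g : ℤ → R) :
    staircaseDet n g
      = Matrix.det (Matrix.of fun i j : Fin n => g (1 + 2 * ((i : ℕ) : ℤ) - ((j : ℕ) : ℤ))) := by
  rw [staircaseDet, ← Matrix.det_submatrix_equiv_self Fin.revPerm]
  congr 1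
  ext i j
  simp only [Matrix.submatrix_apply, Matrix.of_apply, Fin.revPerm_apply, Fin.val_rev]
  congr 1
  have := i.2
  have := j.2
  lia

/-- Staircase determinants do not see even factors of the generating function. -/
lemma staircaseDet_mulLinear_neg_mulLinear (n : ℕ) (b : R) {g : ℤ → R} (hg : ∀ k < 0, g k = 0) :
    staircaseDet n (mulLinear (-b) (mulLinear b g)) = staircaseDet n g := by
  rw [staircaseDet_eq_det_rev, staircaseDet_eq_det_rev]
  cases n with
  | zero => simp
  | succ n =>
    symm
    refine Matrix.det_eq_of_forall_row_eq_smul_add_pred (fun _ => b ^ 2) ?_ ?_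
    · intro j
      simp only [Matrix.of_apply, mulLinear]
      rw [hg (1 + 2 * ((0 : Fin (n + 1)) : ℕ) - (j : ℕ) - 1 - 1) (by simp; lia)]
      ring
    · intro i j
      simp only [Matrix.of_apply, mulLinear, Fin.val_succ, Fin.val_castSucc]
      have e : (1 + 2 * ((i + 1 : ℕ) : ℤ) - (j : ℕ) - 1 - 1) = 1 + 2 * ((i : ℕ) : ℤ) - (j : ℕ) := by
        push_cast; ring
      rw [e]
      ring

/-- Infinite columns of the staircase matrix, truncated to `n` entries. -/
def staircaseCol (n : ℕ) (g : ℤ → R) (j : ℤ) : Fin n → R :=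
  fun i => g ((n : ℤ) - 2 * ((i : ℕ) : ℤ) + j)

lemma staircaseCol_mulLinear (n : ℕ) (a : R) (g : ℤ → R) (j : ℤ) :
    staircaseCol n (mulLinear a g) j = staircaseCol n g j - a • staircaseCol n g (j - 1) := by
  ext i
  simp [staircaseCol, mulLinear, add_sub_assoc]

lemma staircaseDet_eq_det_cols (n : ℕ) (g : ℤ → R) :
    staircaseDet n g = Matrix.det (Matrix.of fun j : Fin n => staircaseCol n g (j : ℕ)) := by
  rw [staircaseDet, ← Matrix.det_transpose]; rfl

lemma staircaseDet_eq_det_cols_succ (m : ℕ) {g : ℤ → R} (hg : ∀ k < 0, g k = 0) (h0 : g 0 = 1) :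
    staircaseDet (m + 1) g
      = Matrix.det (Matrix.of fun j : Fin (m + 2) => staircaseCol (m + 2) g ((j : ℕ) - 1)) := by
  rw [← Matrix.det_transpose, Matrix.det_succ_row _ (Fin.last (m + 1)), Fin.sum_univ_castSucc,
    Finset.sum_eq_zero]
  · simp only [Matrix.transpose_apply, Matrix.of_apply, staircaseCol, Fin.val_last,
      Fin.succAbove_last, zero_add, staircaseDet]
    have e : ((m + 2 : ℕ) : ℤ) - 2 * ((m + 1 : ℕ) : ℤ) + (((m + 1 : ℕ) : ℤ) - 1) = 0 := by
      push_cast; ring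
    rw [e, h0, ← two_mul, pow_mul, neg_one_sq, one_pow, one_mul, one_mul]
    congr 1
    ext i j
    simp only [Matrix.of_apply, Matrix.submatrix_apply, Matrix.transpose_apply]
    congr 1
    simp only [Fin.val_castSucc]
    push_cast
    ring
  · intro j _
    simp only [Matrix.transpose_apply, Matrix.of_apply, staircaseCol, Fin.val_last,
      Fin.val_castSucc]
    rw [hg _ (by have := j.2; push_cast; lia)]
    simp

lemma staircaseDet_eq_endDet (m : ℕ) (c : R) (g : ℤ → R) :
    staircaseDet (m + 2) g
      = endDet (fun i : Fin m => staircaseCol (m + 2) (mulLinear c g) ((i : ℕ) + 1))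
          (staircaseCol (m + 2) (mulLinear c g) (m + 1)) (staircaseCol (m + 2) g 0) := by
  rw [staircaseDet_eq_det_cols, endDet_apply]
  refine Matrix.det_eq_of_forall_row_eq_smul_add_pred (fun _ => c) ?_ ?_
  · intro j; simp [endRows]
  · intro i j
    refine Fin.lastCases ?_ (fun i => ?_) i
    · simp [endRows, staircaseCol_mulLinear]
    · simp [endRows, staircaseCol_mulLinear]

lemma staircaseDet_succ_eq_pairDet (m : ℕ) (c : R) {g : ℤ → R} (hg : ∀ k < 0, g k = 0)
    (h0 : g 0 = 1) :
    staircaseDet (m + 1) g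
      = pairDet (fun i : Fin m => staircaseCol (m + 2) (mulLinear c g) ((i : ℕ) + 1))
          (staircaseCol (m + 2) g (-1)) (staircaseCol (m + 2) (mulLinear c g) 0) := by
  rw [staircaseDet_eq_det_cols_succ m hg h0, pairDet_apply]
  refine Matrix.det_eq_of_forall_row_eq_smul_add_pred (fun _ => c) ?_ ?_
  · intro j; simp [pairRows]
  · intro i j
    refine Fin.cases ?_ (fun i => ?_) i
    · simp [pairRows, staircaseCol_mulLinear]
    · simp [pairRows, staircaseCol_mulLinear]

lemma staircaseDet_succ_eq_pairDet_mulLinear_mulLinear (m : ℕ) (a c : R) {g : ℤ → R}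
    (hg : ∀ k < 0, g k = 0) (h0 : g 0 = 1) :
    staircaseDet (m + 1) g
      = pairDet (fun i : Fin m =>
            staircaseCol (m + 2) (mulLinear c (mulLinear a g)) ((i : ℕ) + 1))
          (staircaseCol (m + 2) g (-1)) (staircaseCol (m + 2) (mulLinear a g) 0) := by
  rw [staircaseDet_succ_eq_pairDet m a hg h0, pairDet_apply, pairDet_apply]
  refine Matrix.det_eq_of_forall_row_eq_smul_add_pred (Fin.cons 0 fun _ => c) ?_ ?_
  · intro j; simp [pairRows]
  · intro i j
    refine Fin.cases ?_ (fun i => ?_) i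
    · simp [pairRows]
    · cases m with
      | zero => exact i.elim0
      | succ m =>
        refine Fin.cases ?_ (fun i => ?_) i
        · simp [pairRows, staircaseCol_mulLinear _ c]
          rw [show (2 : Fin (m + 1 + 1 + 1)) = (0 : Fin (m + 1)).succ.succ from rfl]
          simp only [Fin.cons_succ]
          simp
        · simp [pairRows, staircaseCol_mulLinear _ c]

/-- The bilinear relation of modified KP type for staircase determinants. -/
lemma staircaseDet_bilinear_mulLinear (n : ℕ) (a c : R) {g : ℤ → R} (hg : ∀ k < 0, g k = 0)
    (h0 : g 0 = 1) :
    a * staircaseDet n (mulLinear c g) * staircaseDet (n + 1) (mulLinear a g)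
        - c * staircaseDet n (mulLinear a g) * staircaseDet (n + 1) (mulLinear c g)
      = (a - c) * staircaseDet n g * staircaseDet (n + 1) (mulLinear c (mulLinear a g)) := by
  cases n with
  | zero =>
    simp [staircaseDet, mulLinear, hg, h0]
    ring
  | succ m =>
    have ha := mulLinear_of_neg (a := a) hg
    have hc := mulLinear_of_neg (a := c) hg
    have ha0 : mulLinear a g 0 = 1 := (mulLinear_zero hg).trans h0
    have hc0 : mulLinear c g 0 = 1 := (mulLinear_zero hg).trans h0
    set u : Fin m → Fin (m + 2) → R := fun i =>
      staircaseCol (m + 2) (mulLinear c (mulLinear a g)) ((i : ℕ) + 1) with hu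
    set w := staircaseCol (m + 2) (mulLinear c (mulLinear a g)) (m + 1) with hw
    set x := staircaseCol (m + 2) (mulLinear c (mulLinear a g)) 0 with hx
    have hA : staircaseDet (m + 2) (mulLinear a g)
        = endDet u w (staircaseCol (m + 2) (mulLinear a g) 0) :=
      staircaseDet_eq_endDet m c _
    have hC : staircaseDet (m + 2) (mulLinear c g)
        = endDet u w (staircaseCol (m + 2) (mulLinear c g) 0) := by
      rw [hu, hw, mulLinear_comm c a]
      exact staircaseDet_eq_endDet m a _
    have hU : staircaseDet (m + 2) (mulLinear c (mulLinear a g)) = endDet u w x := by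
      rw [staircaseDet_eq_endDet m 0]
      rw [mulLinear_zero_left]
    have hA' : staircaseDet (m + 1) (mulLinear a g)
        = pairDet u (staircaseCol (m + 2) (mulLinear a g) (-1)) x :=
      staircaseDet_succ_eq_pairDet m c ha ha0
    have hC' : staircaseDet (m + 1) (mulLinear c g)
        = pairDet u (staircaseCol (m + 2) (mulLinear c g) (-1)) x := by
      rw [hu, hx, mulLinear_comm c a]
      exact staircaseDet_succ_eq_pairDet m a hc hc0
    have hG : staircaseDet (m + 1) g
        = pairDet u (staircaseCol (m + 2) g (-1)) (staircaseCol (m + 2) (mulLinear a g) 0) :=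
      staircaseDet_succ_eq_pairDet_mulLinear_mulLinear m a c hg h0
    have xA : x = staircaseCol (m + 2) (mulLinear a g) 0
        - c • staircaseCol (m + 2) (mulLinear a g) (-1) := by
      rw [hx, staircaseCol_mulLinear]; rfl
    have xC : x = staircaseCol (m + 2) (mulLinear c g) 0
        - a • staircaseCol (m + 2) (mulLinear c g) (-1) := by
      rw [hx, mulLinear_comm c a, staircaseCol_mulLinear]; rfl
    have AC : staircaseCol (m + 2) (mulLinear c g) 0 = staircaseCol (m + 2) (mulLinear a g) 0
        + (a - c) • staircaseCol (m + 2) g (-1) := by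
      rw [staircaseCol_mulLinear, staircaseCol_mulLinear, zero_sub, sub_smul]; abel
    have P := pairDet_mul_endDet u w x (staircaseCol (m + 2) (mulLinear a g) 0)
      (staircaseCol (m + 2) (mulLinear c g) 0)
    set A0 := staircaseCol (m + 2) (mulLinear a g) 0
    set A1 := staircaseCol (m + 2) (mulLinear a g) (-1)
    set C0 := staircaseCol (m + 2) (mulLinear c g) 0
    set C1 := staircaseCol (m + 2) (mulLinear c g) (-1)
    set v := staircaseCol (m + 2) g (-1)
    have pA : c * pairDet u A1 x = pairDet u A0 x := by
      have h := pairDet_self u x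
      nth_rewrite 1 [xA] at h
      simp only [map_sub, map_smul, LinearMap.sub_apply, LinearMap.smul_apply, smul_eq_mul] at h
      linear_combination -h
    have pC : a * pairDet u C1 x = pairDet u C0 x := by
      have h := pairDet_self u x
      nth_rewrite 1 [xC] at h
      simp only [map_sub, map_smul, LinearMap.sub_apply, LinearMap.smul_apply, smul_eq_mul] at h
      linear_combination -h
    have pAC : pairDet u C0 A0 = (a - c) * pairDet u v A0 := by
      rw [AC]
      simp [pairDet_self]
    rw [hA, hC, hU, hA', hC', hG, pC, pA, ← pAC]
    rw [pairDet_swap u x A0, pairDet_swap u x C0] at P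
    linear_combination P

lemma staircaseDet_bilinear (n : ℕ) (a b : R) {h : ℤ → R} (hh : ∀ k < 0, h k = 0)
    (h0 : h 0 = 1) :
    b * staircaseDet n (mulLinear a (mulLinear b h)) * staircaseDet (n + 1) h
        + a * staircaseDet n h * staircaseDet (n + 1) (mulLinear a (mulLinear b h))
      = (a + b) * staircaseDet n (mulLinear b h) * staircaseDet (n + 1) (mulLinear a h) := by
  have key := staircaseDet_bilinear_mulLinear n a (-b) (mulLinear_of_neg (a := b) hh)
    ((mulLinear_zero hh).trans h0)
  rw [mulLinear_comm a b, staircaseDet_mulLinear_neg_mulLinear _ _ (mulLinear_of_neg hh),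
    staircaseDet_mulLinear_neg_mulLinear _ _ hh, staircaseDet_mulLinear_neg_mulLinear _ _ hh,
    mulLinear_comm b a] at key
  linear_combination key

end Staircase

section Phi

variable {K : Type*} [Field K]

lemma phiAux_eq_staircaseDet (p : ℤ → K → K → K) (n : ℕ) (y z : K) :
    phiAux p n y z = staircaseDet n fun k => p k y z := rfl

lemma phiAux_swap (p : ℤ → K → K → K) (n : ℕ) (y z : K) :
    phiAux (fun k y z => p k z y) n y z = phiAux p n z y := rfl

lemma phi_swap (p : ℤ → K → K → K) (N : ℤ) (y z : K) :
    phi (fun k y z => p k z y) N y z = phi p N z y := rfl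

lemma phiAux_bilinear {q : K} (hq : q ≠ 1) {p : ℤ → K → K → K}
    (hp_neg : ∀ k : ℤ, k < 0 → ∀ y z : K, p k y z = 0)
    (hp_zero : ∀ y z : K, p 0 y z = 1)
    (hC2 : ∀ (k : ℤ) (y z : K), p k y (q * z) - p k y z = (q - 1) * z * p (k - 1) y z)
    (hC3 : ∀ (k : ℤ) (y z : K), p k (q * y) z - p k y z = (q - 1) * y * p (k - 1) y z)
    (n : ℕ) (y z : K) :
    z * phiAux p n (q * y) (q * z) * phiAux p (n + 1) y z
        + y * phiAux p n y z * phiAux p (n + 1) (q * y) (q * z)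
      = (y + z) * phiAux p n y (q * z) * phiAux p (n + 1) (q * y) z := by
  have e2 : ∀ y z, (fun k => p k y (q * z)) = mulLinear ((1 - q) * z) fun k => p k y z := by
    intro y z; funext k; simp only [mulLinear]; linear_combination hC2 k y z
  have e3 : ∀ y z, (fun k => p k (q * y) z) = mulLinear ((1 - q) * y) fun k => p k y z := by
    intro y z; funext k; simp only [mulLinear]; linear_combination hC3 k y z
  have key := staircaseDet_bilinear n ((1 - q) * y) ((1 - q) * z)
    (h := fun k => p k y z) (fun k hk => hp_neg k hk y z) (hp_zero y z)
  rw [← e2, ← e3, ← e3] at key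
  simp only [← phiAux_eq_staircaseDet] at key
  apply mul_left_cancel₀ (sub_ne_zero.2 hq.symm)
  linear_combination key

lemma phi_bilinear {q : K} (hq : q ≠ 1) {p : ℤ → K → K → K}
    (hp_neg : ∀ k : ℤ, k < 0 → ∀ y z : K, p k y z = 0)
    (hp_zero : ∀ y z : K, p 0 y z = 1)
    (hC2 : ∀ (k : ℤ) (y z : K), p k y (q * z) - p k y z = (q - 1) * z * p (k - 1) y z)
    (hC3 : ∀ (k : ℤ) (y z : K), p k (q * y) z - p k y z = (q - 1) * y * p (k - 1) y z)
    (N : ℤ) (y z : K) :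
    z * phi p (N - 1) (q * y) (q * z) * phi p N y z
        + y * phi p (N - 1) y z * phi p N (q * y) (q * z)
      = (y + z) * phi p (N - 1) y (q * z) * phi p N (q * y) z := by
  rcases lt_trichotomy N 0 with hN | rfl | hN
  · obtain ⟨n, rfl⟩ : ∃ n : ℕ, N = -n - 1 := ⟨(-N - 1).toNat, by lia⟩
    have key := phiAux_bilinear hq (p := fun k y z => p k z y)
      (fun k hk y z => hp_neg k hk z y) (fun y z => hp_zero z y)
      (fun k y z => hC3 k z y) (fun k y z => hC2 k z y) n z y
    simp only [phiAux_swap] at key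
    have e1 : (-(-(n : ℤ) - 1) - 1).toNat = n := by lia
    have e2 : (-(-(n : ℤ) - 1 - 1) - 1).toNat = n + 1 := by lia
    simp only [phi, if_neg (show ¬ 0 ≤ -(n : ℤ) - 1 by lia),
      if_neg (show ¬ 0 ≤ -(n : ℤ) - 1 - 1 by lia), e1, e2]
    generalize (-1 : K) ^ ((-(n : ℤ) - 1) * (-(n : ℤ) - 1 + 1) / 2) = s
    generalize (-1 : K) ^ ((-(n : ℤ) - 1 - 1) * (-(n : ℤ) - 1 - 1 + 1) / 2) = t
    linear_combination s * t * key
  · simp [phi, phiAux]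
    ring
  · obtain ⟨n, rfl⟩ : ∃ n : ℕ, N = n + 1 := ⟨(N - 1).toNat, by lia⟩
    have key := phiAux_bilinear hq hp_neg hp_zero hC2 hC3 n y z
    have e2 : ((n : ℤ) + 1).toNat = n + 1 := by lia
    simpa only [phi, add_sub_cancel_right, if_pos (show 0 ≤ (n : ℤ) by lia),
      if_pos (show 0 ≤ (n : ℤ) + 1 by lia), Int.toNat_natCast, e2] using key

end Phi

theorem multiplicative_formula_F1
    {K : Type*} [Field K] (q : K) (hq0 : q ≠ 0)
    (hq1 : ∀ k : ℕ, 1 ≤ k → q ^ k ≠ 1)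
    (p : ℤ → K → K → K)
    (hp_neg : ∀ k : ℤ, k < 0 → ∀ y z : K, p k y z = 0)
    (hp_zero : ∀ y z : K, p 0 y z = 1)
    (hC1 : ∀ k : ℕ, 1 ≤ k → ∀ y z : K,
      (∑ i ∈ Finset.range k, q ^ i) * p (k : ℤ) y z
        = (y + z + q ^ (k - 1)) * p ((k : ℤ) - 1) y z
          - (1 - q) * y * z * p ((k : ℤ) - 2) y z)
    (hC2 : ∀ (k : ℤ) (y z : K), p k y (q * z) - p k y z = (q - 1) * z * p (k - 1) y z)
    (hC3 : ∀ (k : ℤ) (y z : K), p k (q * y) z - p k y z = (q - 1) * y * p (k - 1) y z)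
    (N : ℤ) (y z : K) (hy : y ≠ 0) (hz : z ≠ 0)
    (h1 : phi p (N - 1) y z ≠ 0) (h2 : phi p N (y / q) (z / q) ≠ 0)
    (F1 : K)
    (hF1 : F1 = phi p (N - 1) (y / q) (z / q) * phi p N y z
      / (phi p (N - 1) y z * phi p N (y / q) (z / q))) :
    1 + y / z * F1 = (1 + y / z) * phi p (N - 1) (y / q) z * phi p N y (z / q)
      / (phi p (N - 1) y z * phi p N (y / q) (z / q)) ∧
    1 + z / y * F1 = (1 + z / y) * phi p (N - 1) y (z / q) * phi p N (y / q) z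
      / (phi p (N - 1) y z * phi p N (y / q) (z / q)) := by
  have hq : q ≠ 1 := by simpa using hq1 1 le_rfl
  have hy' : q * (y / q) = y := mul_div_cancel₀ y hq0
  have hz' : q * (z / q) = z := mul_div_cancel₀ z hq0
  have A := phi_bilinear hq hp_neg hp_zero hC2 hC3 N (y / q) (z / q)
  have B := phi_bilinear hq (p := fun k y z => p k z y)
    (fun k hk y z => hp_neg k hk z y) (fun y z => hp_zero z y)
    (fun k y z => hC3 k z y) (fun k y z => hC2 k z y) N (z / q) (y / q)
  simp only [phi_swap, hy', hz'] at A B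
  field_simp at A B
  subst hF1
  constructor
  · field_simp
    linear_combination A
  · field_simp
    linear_combination B
end

section
/- For every integer N and all y, z ∈ K, the bilinear difference equation holds: φ_{N+1}(y,z)·φ_N(y/q,z) + q^{N+1}·z·φ_{N+1}(y/q,z)·φ_N(y,z) = (1 + z)·φ_{N+1}(y,qz)·φ_N(y/q,z/q). -/
open Matrix Finset

/-- The Plücker exchange relation for two square matrices. -/
theorem det_mul_det_eq_sum_exchange {R n : Type*} [CommRing R] [Fintype n] [DecidableEq n]
    (M N : Matrix n n R) (k : n) :
    N.det * M.det = ∑ i, (N.updateRow i (M k)).det * (M.updateRow k (N i)).det := by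
  have h : N.det • M k = ∑ i, (N.updateRow i (M k)).det • N i := by
    have h1 := Matrix.mulVec_cramer Nᵀ (M k)
    rw [Matrix.det_transpose] at h1
    rw [← h1]
    ext j
    simp [Matrix.mulVec, dotProduct, Matrix.cramer_transpose_apply, Finset.sum_apply, mul_comm]
  have h2 := congrArg
    ((Matrix.detRowAlternating (R := R) (n := n)).toMultilinearMap.toLinearMap M k) h
  rw [map_smul, map_sum] at h2
  simp only [map_smul, smul_eq_mul] at h2
  have h3 : ∀ v : n → R,
      (Matrix.detRowAlternating (R := R) (n := n)).toMultilinearMap.toLinearMap M k v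
        = (M.updateRow k v).det := fun v => rfl
  simp only [h3, Matrix.updateRow_eq_self] at h2
  exact h2

section TwoRows

variable {R : Type*} [CommRing R] {m : ℕ}

theorem det_cons_smul_add_cons (c : R) (x y : Fin (m + 2) → R)
    (X : Fin m → Fin (m + 2) → R) :
    (Matrix.of (vecCons (c • x + y) (vecCons y X))).det
      = c * (Matrix.of (vecCons x (vecCons y X))).det := by
  have h (v : Fin (m + 2) → R) : (Matrix.of (vecCons v (vecCons y X)))
      = (Matrix.of (vecCons x (vecCons y X))).updateRow 0 v := by
    ext i j
    refine Fin.cases ?_ (fun i => ?_) i <;> simp [Matrix.updateRow_apply]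
  rw [h, Matrix.det_updateRow_add, Matrix.det_updateRow_smul, ← h, ← h]
  rw [Matrix.det_zero_of_row_eq (M := Matrix.of (vecCons y (vecCons y X)))
    (i := 0) (j := 1) (by simp) (by ext j; simp)]
  simp

theorem det_cons_cons_swap (x y : Fin (m + 2) → R) (X : Fin m → Fin (m + 2) → R) :
    (Matrix.of (vecCons y (vecCons x X))).det
      = -(Matrix.of (vecCons x (vecCons y X))).det := by
  have h := Matrix.det_permute (Equiv.swap (0 : Fin (m + 2)) 1)
    (Matrix.of (vecCons x (vecCons y X)))
  rw [Equiv.Perm.sign_swap (by simp)] at h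
  rw [show (Matrix.of (vecCons y (vecCons x X))) = (Matrix.of
    (vecCons x (vecCons y X))).submatrix (Equiv.swap (0 : Fin (m + 2)) 1) id from ?_, h]
  · simp
  · ext i j
    refine Fin.cases ?_ (fun i => Fin.cases ?_ (fun i => ?_) i) i
    · simp
    · simp
    · rw [Matrix.submatrix_apply, Equiv.swap_apply_of_ne_of_ne]
      · simp
      · simp
      · simp [Fin.ext_iff]

end TwoRows

/-- Bilinear identity for determinants of consecutive terms of the sequences obtained from a
sequence of vectors `f` by the shifts `g ↦ (k ↦ g k - c • g (k - 1))`, `c = a` or `c = b`. -/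
theorem bilinear_det_shift {R : Type*} [CommRing R] {m : ℕ} (a b : R)
    (f A B t : ℤ → Fin (m + 1) → R) (s : Fin (m + 1) → R)
    (hA : ∀ k, A k = f k - a • f (k - 1)) (hB : ∀ k, B k = f k - b • f (k - 1))
    (htA : ∀ k, t k = A k - b • A (k - 1)) (htB : ∀ k, t k = B k - a • B (k - 1)) :
    a * (Matrix.of (Fin.snoc (fun i : Fin m => A (i : ℕ)) s)).det
          * (Matrix.of fun i : Fin (m + 1) => B ((i : ℕ) - 1)).det
      - b * (Matrix.of (Fin.snoc (fun i : Fin m => B (i : ℕ)) s)).det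
          * (Matrix.of fun i : Fin (m + 1) => A ((i : ℕ) - 1)).det
      = (a - b) * (Matrix.of (Fin.snoc (fun i : Fin m => t (i : ℕ)) s)).det
          * (Matrix.of fun i : Fin (m + 1) => f ((i : ℕ) - 1)).det := by
  cases m with
  | zero =>
    have hs (g : Fin 0 → Fin 1 → R) : (Fin.snoc g s : Fin 1 → Fin 1 → R) 0 0 = s 0 := by
      simp [Fin.snoc]
    simp [hA, hB, hs]
    ring
  | succ m =>
    set X : Fin m → Fin (m + 2) → R := fun i => t ((i : ℕ) + 1) with hX
    have hP (g u : ℤ → Fin (m + 2) → R) (c : R) (hu : ∀ k, u k = g k - c • g (k - 1)) :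
        (Matrix.of fun i : Fin (m + 2) => g ((i : ℕ) - 1)).det
          = (Matrix.of (vecCons (g (-1)) (vecCons (u 0) fun i : Fin m => u ((i : ℕ) + 1)))).det := by
      refine Matrix.det_eq_of_forall_row_eq_smul_add_pred (fun _ => c) (fun j => by simp) ?_
      intro i j
      refine Fin.cases ?_ (fun i => ?_) i
      · simp [hu]
      · simp [hu]
    have hQ (g : ℤ → Fin (m + 2) → R) (c : R) (hu : ∀ k, t k = g k - c • g (k - 1)) :
        (Matrix.of (Fin.snoc (fun i : Fin (m + 1) => g (i : ℕ)) s)).det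
          = ((Matrix.of (Fin.snoc (fun i : Fin (m + 1) => t (i : ℕ)) s)).updateRow 0 (g 0)).det := by
      refine Matrix.det_eq_of_forall_row_eq_smul_add_pred
        (fun i => if (i : ℕ) < m then c else 0) (fun j => by simp [Fin.snoc]) ?_
      intro i j
      have ht : g ((i : ℕ) + 1) j = t ((i : ℕ) + 1) j + c * g (i : ℕ) j := by
        simp [hu ((i : ℕ) + 1)]
      rw [Matrix.updateRow_ne (Fin.succ_ne_zero i)]
      by_cases hi : (i : ℕ) < m
      · simpa [Fin.snoc, hi, hi.le] using ht
      · simp [Fin.snoc, hi]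
    have hf : (Matrix.of (vecCons (f (-1)) (vecCons (A 0) fun i : Fin m => A ((i : ℕ) + 1)))).det
        = (Matrix.of (vecCons (f (-1)) (vecCons (A 0) X))).det := by
      refine Matrix.det_eq_of_forall_row_eq_smul_add_pred
        (Fin.cons 0 fun _ => b) (fun j => by simp) ?_
      intro i j
      refine Fin.cases ?_ (fun i => ?_) i
      · simp
      · have ht : A ((i : ℕ) + 1) j = t ((i : ℕ) + 1) j + b * A (i : ℕ) j := by
          simp [htA ((i : ℕ) + 1)]
        cases m with
        | zero => exact i.elim0
        | succ m =>
          refine Fin.cases (fun ht => ?_) (fun i ht => ?_) i ht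
          · simpa [hX] using ht
          · simpa [hX] using ht
    rw [hP f A a hA, hP A t b htA, hP B t a htB, hf, hQ A b htA, hQ B a htB]
    have e1 : (a - b) * (Matrix.of (vecCons (f (-1)) (vecCons (A 0) X))).det
        = (Matrix.of (vecCons (B 0) (vecCons (A 0) X))).det := by
      rw [← det_cons_smul_add_cons]
      congr 4
      rw [hA, hB]; ext j; simp; ring
    have e2 : b * (Matrix.of (vecCons (A (-1)) (vecCons (t 0) X))).det
        = -(Matrix.of (vecCons (t 0) (vecCons (A 0) X))).det := by
      rw [← det_cons_cons_swap, ← det_cons_smul_add_cons]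
      congr 4
      rw [htA]; ext j; simp
    have e3 : a * (Matrix.of (vecCons (B (-1)) (vecCons (t 0) X))).det
        = (Matrix.of (vecCons (B 0) (vecCons (t 0) X))).det := by
      rw [← det_cons_smul_add_cons]
      congr 4
      rw [htB]; ext j; simp
    have key := det_mul_det_eq_sum_exchange
      (Matrix.of (Fin.snoc (fun i : Fin (m + 1) => t (i : ℕ)) s))
      (Matrix.of (vecCons (B 0) (vecCons (A 0) X))) 0
    rw [Fin.sum_univ_succ, Fin.sum_univ_succ, Finset.sum_eq_zero (s := univ (α := Fin m))] at key
    · have u0 : (Matrix.of (vecCons (B 0) (vecCons (A 0) X))).updateRow 0 (t 0)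
          = Matrix.of (vecCons (t 0) (vecCons (A 0) X)) := by
        ext i j
        refine Fin.cases ?_ (fun i => ?_) i <;> simp [Matrix.updateRow_apply]
      have u1 : (Matrix.of (vecCons (B 0) (vecCons (A 0) X))).updateRow (Fin.succ 0) (t 0)
          = Matrix.of (vecCons (B 0) (vecCons (t 0) X)) := by
        ext i j
        refine Fin.cases ?_ (fun i => Fin.cases ?_ (fun i => ?_) i) i <;>
          simp [Matrix.updateRow_apply, Fin.ext_iff]
      have t0 : (Matrix.of (Fin.snoc (fun i : Fin (m + 1) => t (i : ℕ)) s)) 0 = t 0 := by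
        ext j; simp [Fin.snoc]
      have n0 : (Matrix.of (vecCons (B 0) (vecCons (A 0) X))) 0 = B 0 := rfl
      have n1 : (Matrix.of (vecCons (B 0) (vecCons (A 0) X))) (Fin.succ 0) = A 0 := rfl
      rw [t0, u0, u1, n0, n1, ← e1] at key
      linear_combination (-1 : R) * key
        + ((Matrix.of (Fin.snoc (fun i : Fin (m + 1) => t (i : ℕ)) s)).updateRow 0 (A 0)).det * e3
        - ((Matrix.of (Fin.snoc (fun i : Fin (m + 1) => t (i : ℕ)) s)).updateRow 0 (B 0)).det * e2
    · intro i _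
      refine mul_eq_zero_of_right _ (Matrix.det_zero_of_row_eq
        (i := 0) (j := i.succ.castSucc) (by simp [Fin.ext_iff]) ?_)
      ext j
      simp [Fin.snoc, Matrix.updateRow_apply, Fin.ext_iff, hX]

/-- The Jacobi-Trudi determinant of staircase shape attached to a sequence `g`. -/
def stairDet {R : Type*} [CommRing R] (n : ℕ) (g : ℤ → R) : R :=
  Matrix.det (Matrix.of fun i j : Fin n => g ((n : ℤ) - 2 * ((i : ℕ) : ℤ) + ((j : ℕ) : ℤ)))

/-- The `k`-th extended column of the staircase Jacobi-Trudi matrix with `n` rows. -/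
def stairCol {R : Type*} (n : ℕ) (g : ℤ → R) (k : ℤ) : Fin n → R :=
  fun r => g ((n : ℤ) - 2 * ((r : ℕ) : ℤ) + k)

section Staircase

variable {R : Type*} [CommRing R]

theorem stairDet_eq_det_stairCol (n : ℕ) (g : ℤ → R) :
    stairDet n g = (Matrix.of fun i : Fin n => stairCol n g (i : ℕ)).det := by
  rw [stairDet, ← Matrix.det_transpose]
  rfl

theorem det_stairCol_pred (n : ℕ) (g : ℤ → R) (hneg : ∀ k < 0, g k = 0) (h0 : g 0 = 1) :
    (Matrix.of fun i : Fin (n + 1) => stairCol (n + 1) g ((i : ℕ) - 1)).det = stairDet n g := by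
  rw [Matrix.det_succ_column _ (Fin.last n), Fin.sum_univ_castSucc, Finset.sum_eq_zero, zero_add]
  · have h1 : (n : ℤ) + 1 - 2 * n + (n - 1) = 0 := by ring
    simp only [Matrix.of_apply, stairCol, Fin.val_last, Nat.cast_add, Nat.cast_one, h1, h0]
    rw [stairDet_eq_det_stairCol, ← two_mul, pow_mul, neg_one_sq, one_pow, one_mul, one_mul]
    congr 1
    ext i j
    simp only [Matrix.submatrix_apply, Matrix.of_apply, stairCol, Fin.succAbove_last,
      Fin.val_castSucc]
    congr 1
    push_cast
    ring
  · intro i _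
    have h1 : g (((n + 1 : ℕ) : ℤ) - 2 * ((Fin.last n : ℕ) : ℤ)
        + (((i.castSucc : Fin (n + 1)) : ℕ) - 1)) = 0 := by
      apply hneg
      have := i.isLt
      simp only [Fin.val_last, Fin.val_castSucc]
      omega
    simp only [Matrix.of_apply, stairCol, h1]
    ring

theorem det_snoc_stairCol_single (n : ℕ) (g : ℤ → R) :
    (Matrix.of (Fin.snoc (fun i : Fin n => stairCol (n + 1) g ((i : ℕ) + 1))
      (Pi.single 0 1 : Fin (n + 1) → R))).det = (-1) ^ n * stairDet n g := by
  rw [Matrix.det_succ_row _ (Fin.last n), Fin.sum_univ_succ, Finset.sum_eq_zero, add_zero]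
  · rw [stairDet_eq_det_stairCol]
    have h1 : (Matrix.of (Fin.snoc (fun i : Fin n => stairCol (n + 1) g ((i : ℕ) + 1))
        (Pi.single 0 1 : Fin (n + 1) → R))) (Fin.last n) 0 = 1 := by simp
    rw [h1]
    simp only [Fin.val_last, Fin.val_zero, add_zero, mul_one]
    congr 2
    ext i j
    simp only [Matrix.submatrix_apply, Matrix.of_apply, Fin.succAbove_last, Fin.snoc_castSucc,
      stairCol, Fin.succAbove_zero, Fin.val_succ]
    congr 1
    push_cast
    ring
  · intro i _
    simp

theorem det_snoc_stairCol_sub (n : ℕ) (c : R) (g u : ℤ → R) (hu : ∀ k, u k = g k - c * g (k - 1)) :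
    (Matrix.of (Fin.snoc (fun i : Fin (n + 1) => stairCol (n + 2) g (i : ℕ))
      (stairCol (n + 2) u ((n + 1 : ℕ) : ℤ)))).det = stairDet (n + 2) g := by
  rw [stairDet_eq_det_stairCol]
  symm
  refine Matrix.det_eq_of_forall_row_eq_smul_add_pred
    (fun i => if (i : ℕ) < n then 0 else c) (fun j => by simp [Fin.snoc]) ?_
  intro i j
  by_cases hi : (i : ℕ) < n
  · simp [Fin.snoc, hi]
  · have hi' : (i : ℕ) = n := by omega
    simp [Fin.snoc, hi', stairCol, hu]
    ring_nf

/-- The bilinear identity lowering the staircase by its first column. -/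
theorem bilinear_stairDet_succ_left (n : ℕ) (a b : R) (f A B t : ℤ → R)
    (hA : ∀ k, A k = f k - a * f (k - 1)) (hB : ∀ k, B k = f k - b * f (k - 1))
    (htA : ∀ k, t k = A k - b * A (k - 1)) (htB : ∀ k, t k = B k - a * B (k - 1))
    (hneg : ∀ k < 0, f k = 0) (h0 : f 0 = 1) :
    a * stairDet (n + 1) A * stairDet n B - b * stairDet (n + 1) B * stairDet n A
      = (a - b) * stairDet (n + 1) t * stairDet n f := by
  have hfm : f (-1) = 0 := hneg _ (by norm_num)
  cases n with
  | zero =>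
    have hA1 := hA 1
    have hB1 := hB 1
    have ht1 := htA 1
    have hA0 := hA 0
    norm_num [h0, hfm] at hA1 hB1 ht1 hA0
    simp [stairDet, ht1, hA0, hA1, hB1]
    ring
  | succ n =>
    have hAneg : ∀ k < 0, A k = 0 := fun k hk => by
      rw [hA, hneg k hk, hneg (k - 1) (by omega)]; ring
    have hBneg : ∀ k < 0, B k = 0 := fun k hk => by
      rw [hB, hneg k hk, hneg (k - 1) (by omega)]; ring
    have hA0 : A 0 = 1 := by rw [hA, h0, zero_sub, hfm]; ring
    have hB0 : B 0 = 1 := by rw [hB, h0, zero_sub, hfm]; ring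
    have lift (c : R) (g u : ℤ → R) (hu : ∀ k, u k = g k - c * g (k - 1)) (k : ℤ) :
        stairCol (n + 2) u k = stairCol (n + 2) g k - c • stairCol (n + 2) g (k - 1) := by
      ext r
      simp [stairCol, hu, add_sub_assoc]
    have key := bilinear_det_shift a b (stairCol (n + 2) f) (stairCol (n + 2) A)
      (stairCol (n + 2) B) (stairCol (n + 2) t) (stairCol (n + 2) t ((n + 1 : ℕ) : ℤ))
      (lift a f A hA) (lift b f B hB) (lift b A t htA) (lift a B t htB)
    rw [det_snoc_stairCol_sub n b A t htA, det_snoc_stairCol_sub n a B t htB,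
      det_stairCol_pred _ _ hAneg hA0, det_stairCol_pred _ _ hBneg hB0,
      det_stairCol_pred _ _ hneg h0] at key
    rw [key, stairDet_eq_det_stairCol (n + 1 + 1) t]
    congr 4
    ext i j
    refine Fin.lastCases ?_ (fun i => ?_) i <;> simp

/-- The bilinear identity lowering the staircase by its first row. -/
theorem bilinear_stairDet_succ_right (n : ℕ) (a b : R) (f A B t : ℤ → R)
    (hA : ∀ k, A k = f k - a * f (k - 1)) (hB : ∀ k, B k = f k - b * f (k - 1))
    (htA : ∀ k, t k = A k - b * A (k - 1)) (htB : ∀ k, t k = B k - a * B (k - 1)) :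
    a * stairDet n A * stairDet (n + 1) B - b * stairDet n B * stairDet (n + 1) A
      = (a - b) * stairDet n t * stairDet (n + 1) f := by
  have lift (c : R) (g u : ℤ → R) (hu : ∀ k, u k = g k - c * g (k - 1)) (k : ℤ) :
      stairCol (n + 1) u (k + 1)
        = stairCol (n + 1) g (k + 1) - c • stairCol (n + 1) g (k - 1 + 1) := by
    ext r
    simp only [stairCol, hu, Pi.sub_apply, Pi.smul_apply, smul_eq_mul]
    ring_nf
  have key := bilinear_det_shift a b (fun k => stairCol (n + 1) f (k + 1))
    (fun k => stairCol (n + 1) A (k + 1)) (fun k => stairCol (n + 1) B (k + 1))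
    (fun k => stairCol (n + 1) t (k + 1)) (Pi.single 0 1)
    (lift a f A hA) (lift b f B hB) (lift b A t htA) (lift a B t htB)
  simp only [det_snoc_stairCol_single, sub_add_cancel, ← stairDet_eq_det_stairCol] at key
  have hs : ((-1 : R) ^ n) * (-1) ^ n = 1 := by rw [← mul_pow]; simp
  linear_combination (-1 : R) ^ n * key
    - (a * stairDet n A * stairDet (n + 1) B - b * stairDet n B * stairDet (n + 1) A
      - (a - b) * stairDet n t * stairDet (n + 1) f) * hs

end Staircase

theorem stairDet_zpow_mul {K : Type*} [Field K] {q : K} (hq : q ≠ 0) (n : ℕ) (g : ℤ → K) :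
    stairDet n (fun k => q ^ k * g k) = (∏ i ∈ Finset.range n, q ^ (n - i)) * stairDet n g := by
  have h : (Matrix.of fun i j : Fin n => (fun k => q ^ k * g k)
        ((n : ℤ) - 2 * ((i : ℕ) : ℤ) + ((j : ℕ) : ℤ)))
      = Matrix.of fun i j : Fin n => q ^ ((n : ℤ) - 2 * ((i : ℕ) : ℤ)) *
        (Matrix.of fun i j : Fin n => q ^ (j : ℕ) *
          (Matrix.of fun i j : Fin n => g ((n : ℤ) - 2 * ((i : ℕ) : ℤ) + ((j : ℕ) : ℤ))) i j) i j := by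
    ext i j
    simp only [Matrix.of_apply]
    rw [zpow_add₀ hq, zpow_natCast, mul_assoc]
  rw [stairDet, h, Matrix.det_mul_column, Matrix.det_mul_row, ← mul_assoc,
    ← Finset.prod_mul_distrib, Finset.prod_range, stairDet]
  congr 1
  refine Finset.prod_congr rfl fun i _ => ?_
  rw [← zpow_natCast q (i : ℕ), ← zpow_add₀ hq, ← zpow_natCast, Nat.cast_sub i.isLt.le]
  congr 1
  ring

theorem bilinear_bl1
    {K : Type*} [Field K] (q : K) (hq0 : q ≠ 0)
    (hq1 : ∀ k : ℕ, 1 ≤ k → q ^ k ≠ 1)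
    (p : ℤ → K → K → K)
    (hp_neg : ∀ k : ℤ, k < 0 → ∀ y z : K, p k y z = 0)
    (hp_zero : ∀ y z : K, p 0 y z = 1)
    (hC1 : ∀ k : ℕ, 1 ≤ k → ∀ y z : K,
      (∑ i ∈ Finset.range k, q ^ i) * p (k : ℤ) y z
        = (y + z + q ^ (k - 1)) * p ((k : ℤ) - 1) y z
          - (1 - q) * y * z * p ((k : ℤ) - 2) y z)
    (hC2 : ∀ (k : ℤ) (y z : K), p k y (q * z) - p k y z = (q - 1) * z * p (k - 1) y z)
    (hC3 : ∀ (k : ℤ) (y z : K), p k (q * y) z - p k y z = (q - 1) * y * p (k - 1) y z)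
    (N : ℤ) (y z : K) :
    phi p (N + 1) y z * phi p N (y / q) z
      + q ^ (N + 1) * z * phi p (N + 1) (y / q) z * phi p N y z
    = (1 + z) * phi p (N + 1) y (q * z) * phi p N (y / q) (z / q) := by
  have hq_sub : q - 1 ≠ 0 := sub_ne_zero.mpr (by simpa using hq1 1 le_rfl)
  have hqy : q * (y / q) = y := mul_div_cancel₀ y hq0
  have hqz : q * (z / q) = z := mul_div_cancel₀ z hq0
  set f : ℤ → K := fun k => q ^ k * p k (y / q) (z / q) with hf
  set A : ℤ → K := fun k => p k y z with hAdef
  set B : ℤ → K := fun k => q ^ k * p k (y / q) z with hBdef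
  set t : ℤ → K := fun k => p k y (q * z) with htdef
  have hA : ∀ k, A k = f k - (q - 1) * f (k - 1) := by
    intro k
    rcases lt_trichotomy k 0 with hk | rfl | hk
    · simp [hf, hAdef, hp_neg k hk, hp_neg (k - 1) (by omega)]
    · simp [hf, hAdef, hp_zero, hp_neg (-1) (by norm_num)]
    · obtain ⟨m, rfl⟩ : ∃ m : ℕ, k = (m : ℤ) + 1 := ⟨(k - 1).toNat, by omega⟩
      have c1 := hC1 (m + 1) (by omega) (y / q) (z / q)
      have g := geom_sum_mul q (m + 1)
      have c2 := hC2 ((m : ℤ) + 1) (y / q) (z / q)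
      have c3 := hC3 ((m : ℤ) + 1) (y / q) z
      have c2' := hC2 ((m : ℤ) + 1 - 1) (y / q) (z / q)
      rw [hqz] at c2 c2'
      rw [hqy] at c3
      have e : (m : ℤ) + 1 - 1 - 1 = (m : ℤ) + 1 - 2 := by ring
      rw [e] at c2'
      simp only [Nat.cast_add, Nat.cast_one, Nat.add_sub_cancel] at c1
      have z1 : q ^ ((m : ℤ) + 1) = q ^ (m + 1) := by rw [← zpow_natCast]; simp
      have z2 : q ^ ((m : ℤ) + 1 - 1) = q ^ m := by rw [← zpow_natCast]; simp
      simp only [hf, hAdef, z1, z2]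
      linear_combination c3 + c2 + (q - 1) * (y / q) * c2' - (q - 1) * c1
        + p ((m : ℤ) + 1) (y / q) (z / q) * g
  have hB : ∀ k, B k = f k - (1 - q) * z * f (k - 1) := by
    intro k
    have c2 := hC2 k (y / q) (z / q)
    rw [hqz] at c2
    simp only [hf, hBdef, zpow_sub_one₀ hq0]
    linear_combination q ^ k * c2
  have htA : ∀ k, t k = A k - (1 - q) * z * A (k - 1) := by
    intro k
    linear_combination hC2 k y z
  have htB : ∀ k, t k = B k - (q - 1) * B (k - 1) := by
    intro k
    rw [htA, hA, hA, hB, hB]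
    ring
  have hfneg : ∀ k < 0, f k = 0 := fun k hk => by simp [hf, hp_neg k hk]
  have hf0 : f 0 = 1 := by simp [hf, hp_zero]
  have hEf (n : ℕ) := stairDet_zpow_mul hq0 n (fun k => p k (y / q) (z / q))
  have hEB (n : ℕ) := stairDet_zpow_mul hq0 n (fun k => p k (y / q) z)
  have hE (n : ℕ) : ∏ i ∈ Finset.range n, q ^ (n - i) ≠ 0 :=
    Finset.prod_ne_zero_iff.mpr fun _ _ => pow_ne_zero _ hq0
  have hE_succ (n : ℕ) : ∏ i ∈ Finset.range (n + 1), q ^ (n + 1 - i)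
      = (∏ i ∈ Finset.range n, q ^ (n - i)) * q ^ (n + 1) := by
    rw [Finset.prod_range_succ']
    simp
  have hphi (n : ℕ) (u v : K) : phiAux p n u v = stairDet n (fun k => p k u v) := rfl
  rcases le_or_gt 0 N with hN | hN
  · obtain ⟨n, rfl⟩ := Int.eq_ofNat_of_zero_le hN
    have key := bilinear_stairDet_succ_left n (q - 1) ((1 - q) * z) f A B t hA hB htA htB
      hfneg hf0
    rw [hEB, hEB, hEf, hE_succ] at key
    have hn : ((n : ℤ) + 1).toNat = n + 1 := by omega
    have hz : q ^ ((n : ℤ) + 1) = q ^ (n + 1) := by rw [← zpow_natCast]; simp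
    simp only [phi, if_pos hN, if_pos (show (0 : ℤ) ≤ (n : ℤ) + 1 by omega), hn,
      Int.toNat_natCast, hphi, hz]
    refine mul_left_cancel₀ (mul_ne_zero hq_sub (hE n)) ?_
    linear_combination key
  · obtain rfl | hN' := eq_or_ne N (-1)
    · simp [phi, phiAux]
    · obtain ⟨n, rfl⟩ : ∃ n : ℕ, N = -(n : ℤ) - 2 := ⟨(-N - 2).toNat, by omega⟩
      have key := bilinear_stairDet_succ_right n (q - 1) ((1 - q) * z) f A B t hA hB htA htB
      rw [hEB, hEB, hEf, hE_succ] at key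
      have hn : (-(-(n : ℤ) - 2) - 1).toNat = n + 1 := by omega
      have hn' : (-(-(n : ℤ) - 2 + 1) - 1).toNat = n := by omega
      have hz : q ^ (-(n : ℤ) - 2 + 1) * q ^ (n + 1) = 1 := by
        rw [← zpow_natCast, ← zpow_add₀ hq0,
          show -(n : ℤ) - 2 + 1 + ((n + 1 : ℕ) : ℤ) = 0 by push_cast; ring, zpow_zero]
      simp only [phi, if_neg hN.not_ge, if_neg (show ¬ (0 : ℤ) ≤ -(n : ℤ) - 2 + 1 by omega),
        hn, hn', hphi]
      generalize (-1 : K) ^ ((-(n : ℤ) - 2) * (-(n : ℤ) - 2 + 1) / 2) = s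
      generalize (-1 : K) ^ ((-(n : ℤ) - 2 + 1) * (-(n : ℤ) - 2 + 1 + 1) / 2) = s'
      refine mul_left_cancel₀ (mul_ne_zero hq_sub
        (mul_ne_zero (hE n) (pow_ne_zero (n + 1) hq0))) ?_
      linear_combination s * s' * key + (q - 1) * (∏ i ∈ Finset.range n, q ^ (n - i)) * s * s' * z
        * stairDet n (fun k => p k (y / q) z) * stairDet (n + 1) A * hz
end
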